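/- Let B > 0 and let u : (0,∞) → ℝ be twice differentiable and satisfy (1+Br²)·u''(r) + (7/r + 8Br)·u'(r) + (8/r² + 12B)·u(r) − 8/r² = 12B for all r > 0. Then there exist real constants A and C such that u(r) = 1 + (C·√(1+Br²))/r⁴ + A/r⁴ for all r > 0. -/

import Mathlib

theorem eq_apply_one_of_hasDerivAt_zero {f : ℝ → ℝ}
    (hf : ∀ r : ℝ, 0 < r → HasDerivAt f 0 r) {r : ℝ} (hr : 0 < r) : f r = f 1 :=
  isOpen_Ioi.is_const_of_deriv_eq_zero isPreconnected_Ioi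
    (fun x hx => (hf x hx).differentiableAt.differentiableWithinAt)
    (fun x hx => (hf x hx).deriv) (Set.mem_Ioi.2 hr) (Set.mem_Ioi.2 one_pos)

theorem hasDerivAt_sqrt_one_add_mul_sq {B : ℝ} (hB : 0 < B) (r : ℝ) :
    HasDerivAt (fun x => √(1 + B * x ^ 2)) (B * r / √(1 + B * r ^ 2)) r := by
  have hs : 1 + B * r ^ 2 ≠ 0 := by positivity
  refine ((((hasDerivAt_pow 2 r).const_mul B).const_add 1).sqrt hs).congr_deriv ?_
  push_cast
  ring

/-- The general solution of the constant-scalar-curvature equation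
(1+Br²)·u'' + (7/r + 8Br)·u' + (8/r² + 12B)·u − 8/r² = 12B on (0,∞), for B > 0,
is u = 1 + C·√(1+Br²)/r⁴ + A/r⁴. -/
theorem eguchi_hanson_typeII_ode_general_solution (B : ℝ) (hB : 0 < B)
    (u : ℝ → ℝ)
    (hu1 : ∀ r : ℝ, 0 < r → DifferentiableAt ℝ u r)
    (hu2 : ∀ r : ℝ, 0 < r → DifferentiableAt ℝ (deriv u) r)
    (hode : ∀ r : ℝ, 0 < r →
      (1 + B * r ^ 2) * deriv (deriv u) r
        + (7 / r + 8 * B * r) * deriv u r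
        + (8 / r ^ 2 + 12 * B) * u r - 8 / r ^ 2 = 12 * B) :
    ∃ A C : ℝ, ∀ r : ℝ, 0 < r →
      u r = 1 + C * Real.sqrt (1 + B * r ^ 2) / r ^ 4 + A / r ^ 4 := by
  have hd (r : ℝ) (hr : 0 < r) : HasDerivAt u (deriv u r) r := (hu1 r hr).hasDerivAt
  have hdd (r : ℝ) (hr : 0 < r) : HasDerivAt (deriv u) (deriv (deriv u) r) r :=
    (hu2 r hr).hasDerivAt
  -- With `w = r ^ 4 * (u - 1)`, the equation says that `g = √(1 + B * r ^ 2) * w' / r` is constant.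
  set g : ℝ → ℝ := fun r =>
    √(1 + B * r ^ 2) * (4 * r ^ 2 * (u r - 1) + r ^ 3 * deriv u r) with hg
  have hg' (r : ℝ) (hr : 0 < r) : HasDerivAt g 0 r := by
    have hs : 0 < 1 + B * r ^ 2 := by positivity
    have hq : 0 < √(1 + B * r ^ 2) := Real.sqrt_pos.2 hs
    have hq2 : √(1 + B * r ^ 2) ^ 2 = 1 + B * r ^ 2 := Real.sq_sqrt hs.le
    have h := (hasDerivAt_sqrt_one_add_mul_sq hB r).fun_mul
      ((((hasDerivAt_pow 2 r).const_mul 4).fun_mul ((hd r hr).sub_const 1)).fun_add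
        ((hasDerivAt_pow 3 r).fun_mul (hdd r hr)))
    refine h.congr_deriv ?_
    have ho := hode r hr
    generalize √(1 + B * r ^ 2) = q at *
    field_simp at ho ⊢
    push_cast
    rw [hq2]
    linear_combination r * ho
  have hw' (r : ℝ) (hr : 0 < r) :
      HasDerivAt (fun x => x ^ 4 * (u x - 1) - g 1 / B * √(1 + B * x ^ 2)) 0 r := by
    have hs : 0 < 1 + B * r ^ 2 := by positivity
    have hq : 0 < √(1 + B * r ^ 2) := Real.sqrt_pos.2 hs
    have h := ((hasDerivAt_pow 4 r).fun_mul ((hd r hr).sub_const 1)).fun_sub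
      ((hasDerivAt_sqrt_one_add_mul_sq hB r).const_mul (g 1 / B))
    refine h.congr_deriv ?_
    have hc : g r = g 1 := eq_apply_one_of_hasDerivAt_zero hg' hr
    rw [← hc, hg]
    field_simp
    push_cast
    ring
  refine ⟨1 ^ 4 * (u 1 - 1) - g 1 / B * √(1 + B * 1 ^ 2), g 1 / B, fun r hr => ?_⟩
  have h := eq_apply_one_of_hasDerivAt_zero hw' hr
  rw [← h]
  field_simp
  ring
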